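/- Let n = 1; let F : ℝ×ℝᵐ → ℝ be continuously differentiable and f, g : ℝ×ℝᵐ → ℝᵖ-valued data be three times continuously differentiable; assume inf-compactness at x̄. Suppose (x̄,ȳ) is a local minimizer of the bilevel program with no upper-level constraints (ȳ ∈ S(x̄) and F(x̄,ȳ) ≤ F(x,y) for all (x,y) near (x̄,ȳ) with y ∈ S(x)), that S(x̄) = {ȳ}, and that ȳ is a nondegenerate critical point of L(x̄) (ND1–ND3) with multiplier ū (extended by zero outside J₀ := J₀(x̄,ȳ)). Then: (a) (x̄,ȳ,ū) is a local minimizer of the nonlinear program: min F(x,y) subject to ∇_y f(x,y) + Σ_{j∈J₀} u_j ∇_y g_j(x,y) = 0 and g_j(x,y) = 0 for all j ∈ J₀; and (b) there exist w ∈ ℝᵐ and ξ ∈ ℝᵖ such that 0 = ∇_x F(x̄,ȳ) − [∇²_{xy}(f + ūᵀg)(x̄,ȳ)]w + ∇_x(ξᵀg)(x̄,ȳ), 0 = ∇_y F(x̄,ȳ) − [∇²_{yy}(f + ūᵀg)(x̄,ȳ)]w + ∇_y(ξᵀg)(x̄,ȳ), ξ_i = 0 for all i ∉ J₀, and ⟨∇_y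 g_j(x̄,ȳ), w⟩ = 0 for all j ∈ J₀. -/

import Mathlib

open scoped RealInnerProductSpace Classical
open Topology

noncomputable section

/-- The lower-level feasible set `Y(x) = {y : g(x,y) ≤ 0}`. -/
def Yset {m p : ℕ} (g : ℝ × EuclideanSpace ℝ (Fin m) → Fin p → ℝ)
    (x : ℝ) : Set (EuclideanSpace ℝ (Fin m)) :=
  {y | ∀ j, g (x, y) j ≤ 0}

/-- The lower-level solution set `S(x)`. -/
def Sset {m p : ℕ} (f : ℝ × EuclideanSpace ℝ (Fin m) → ℝ)
    (g : ℝ × EuclideanSpace ℝ (Fin m) → Fin p → ℝ)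
    (x : ℝ) : Set (EuclideanSpace ℝ (Fin m)) :=
  {y | y ∈ Yset g x ∧ ∀ y' ∈ Yset g x, f (x, y) ≤ f (x, y')}

/-- The partial gradient `∇_y f (x,y)` (upper-level variable one-dimensional). -/
def gradY {m : ℕ} (f : ℝ × EuclideanSpace ℝ (Fin m) → ℝ)
    (x : ℝ) (y : EuclideanSpace ℝ (Fin m)) : EuclideanSpace ℝ (Fin m) :=
  gradient (fun y' => f (x, y')) y

/-- The partial gradient `∇_y g_j (x,y)`. -/
def gradYg {m p : ℕ} (g : ℝ × EuclideanSpace ℝ (Fin m) → Fin p → ℝ)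
    (x : ℝ) (y : EuclideanSpace ℝ (Fin m)) (j : Fin p) : EuclideanSpace ℝ (Fin m) :=
  gradient (fun y' => g (x, y') j) y

/-- The lower-level Lagrangian `f + ūᵀ g`. -/
def Lag {m p : ℕ} (f : ℝ × EuclideanSpace ℝ (Fin m) → ℝ)
    (g : ℝ × EuclideanSpace ℝ (Fin m) → Fin p → ℝ) (u : Fin p → ℝ) :
    ℝ × EuclideanSpace ℝ (Fin m) → ℝ :=
  fun z => f z + ∑ j, u j * g z j

/-- The Hessian block `∇²_{yy}(f + ūᵀg)(x̄,ȳ)` as a continuous linear map. -/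
def LagYY {m p : ℕ} (f : ℝ × EuclideanSpace ℝ (Fin m) → ℝ)
    (g : ℝ × EuclideanSpace ℝ (Fin m) → Fin p → ℝ) (u : Fin p → ℝ)
    (x : ℝ) (y : EuclideanSpace ℝ (Fin m)) :
    EuclideanSpace ℝ (Fin m) →L[ℝ] EuclideanSpace ℝ (Fin m) :=
  fderiv ℝ (fun y' => gradY (Lag f g u) x y') y

/-- The mixed second-derivative block `∇²_{xy}(f + ūᵀg)(x̄,ȳ)` (a vector, since `n = 1`). -/
def LagMix {m p : ℕ} (f : ℝ × EuclideanSpace ℝ (Fin m) → ℝ)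
    (g : ℝ × EuclideanSpace ℝ (Fin m) → Fin p → ℝ) (u : Fin p → ℝ)
    (x : ℝ) (y : EuclideanSpace ℝ (Fin m)) : EuclideanSpace ℝ (Fin m) :=
  deriv (fun x' => gradY (Lag f g u) x' y) x


abbrev Eu (m : ℕ) := EuclideanSpace ℝ (Fin m)

lemma fderiv_slice {m : ℕ} {f : ℝ × Eu m → ℝ} {x : ℝ} {y : Eu m}
    (hf : DifferentiableAt ℝ f (x, y)) :
    HasFDerivAt (fun y' => f (x, y')) ((fderiv ℝ f (x, y)).comp (ContinuousLinearMap.inr ℝ ℝ (Eu m))) y :=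
  HasFDerivAt.comp y (f := fun y' : Eu m => (x, y')) hf.hasFDerivAt (hasFDerivAt_prodMk_right x y)

lemma gradY_eq {m : ℕ} {f : ℝ × Eu m → ℝ} {x : ℝ} {y : Eu m}
    (hf : DifferentiableAt ℝ f (x, y)) :
    gradY f x y = (InnerProductSpace.toDual ℝ (Eu m)).symm
      ((fderiv ℝ f (x, y)).comp (ContinuousLinearMap.inr ℝ ℝ (Eu m))) := by
  rw [gradY, gradient, (fderiv_slice hf).fderiv]

lemma inner_gradY {m : ℕ} {f : ℝ × Eu m → ℝ} {x : ℝ} {y : Eu m}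
    (hf : DifferentiableAt ℝ f (x, y)) (v : Eu m) :
    ⟪gradY f x y, v⟫ = fderiv ℝ f (x, y) (0, v) := by
  rw [gradY_eq hf, InnerProductSpace.toDual_symm_apply]; simp

lemma contDiff_gradY {m : ℕ} {f : ℝ × Eu m → ℝ} (hf : ContDiff ℝ 3 f) :
    ContDiff ℝ 1 (fun z : ℝ × Eu m => gradY f z.1 z.2) := by
  have hd : Differentiable ℝ f := hf.differentiable (by norm_num)
  have : (fun z : ℝ × Eu m => gradY f z.1 z.2) = fun z =>
      (InnerProductSpace.toDual ℝ (Eu m)).symm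
      ((fderiv ℝ f z).comp (ContinuousLinearMap.inr ℝ ℝ (Eu m))) := by
    funext z; exact gradY_eq (hd _)
  rw [this]
  have h1 : ContDiff ℝ 1 (fderiv ℝ f) := hf.fderiv_right (by norm_num)
  exact (InnerProductSpace.toDual ℝ (Eu m)).symm.toContinuousLinearEquiv.contDiff.comp
    (h1.clm_comp contDiff_const)

lemma gradYg_eq {m p : ℕ} (g : ℝ × Eu m → Fin p → ℝ) (x : ℝ) (y : Eu m) (j : Fin p) :
    gradYg g x y j = gradY (fun z => g z j) x y := rfl

lemma gradY_Lag {m p : ℕ} {f : ℝ × Eu m → ℝ} {g : ℝ × Eu m → Fin p → ℝ}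
    (hf : Differentiable ℝ f) (hg : ∀ j, Differentiable ℝ (fun z => g z j)) (u : Fin p → ℝ)
    (x : ℝ) (y : Eu m) :
    gradY (Lag f g u) x y = gradY f x y + ∑ j, u j • gradYg g x y j := by
  have hL : HasFDerivAt (Lag f g u) (fderiv ℝ f (x, y) +
      ∑ j, u j • fderiv ℝ (fun z => g z j) (x, y)) (x, y) :=
    ((hf _).hasFDerivAt).add (HasFDerivAt.fun_sum fun j _ => ((hg j _).hasFDerivAt.const_mul (u j)))
  apply ext_inner_right ℝ
  intro v
  rw [inner_gradY hL.differentiableAt, hL.fderiv, inner_add_left, sum_inner, inner_gradY (hf _)]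
  simp only [add_apply, sum_apply, smul_apply,
    inner_smul_left, gradYg_eq, inner_gradY (hg _ _)]
  simp

lemma contDiff_Lag {m p : ℕ} {f : ℝ × Eu m → ℝ} {g : ℝ × Eu m → Fin p → ℝ}
    (hf : ContDiff ℝ 3 f) (hg : ∀ j, ContDiff ℝ 3 (fun z => g z j)) (u : Fin p → ℝ) :
    ContDiff ℝ 3 (Lag f g u) :=
  hf.add (ContDiff.sum fun j _ => contDiff_const.mul (hg j))

lemma LagYY_apply {m p : ℕ} {f : ℝ × Eu m → ℝ} {g : ℝ × Eu m → Fin p → ℝ}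
    (hf : ContDiff ℝ 3 f) (hg : ∀ j, ContDiff ℝ 3 (fun z => g z j)) (u : Fin p → ℝ)
    (x : ℝ) (y w : Eu m) :
    LagYY f g u x y w = fderiv ℝ (fun z : ℝ × Eu m => gradY (Lag f g u) z.1 z.2) (x, y) (0, w) := by
  have h := (contDiff_gradY (contDiff_Lag hf hg u)).differentiable (by norm_num) (x, y)
  have := HasFDerivAt.comp y (f := fun y' : Eu m => (x, y')) h.hasFDerivAt
    (hasFDerivAt_prodMk_right x y)
  rw [LagYY]
  erw [this.fderiv]
  simp

lemma LagMix_eq {m p : ℕ} {f : ℝ × Eu m → ℝ} {g : ℝ × Eu m → Fin p → ℝ}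
    (hf : ContDiff ℝ 3 f) (hg : ∀ j, ContDiff ℝ 3 (fun z => g z j)) (u : Fin p → ℝ)
    (x : ℝ) (y : Eu m) :
    LagMix f g u x y = fderiv ℝ (fun z : ℝ × Eu m => gradY (Lag f g u) z.1 z.2) (x, y) (1, 0) := by
  have h := (contDiff_gradY (contDiff_Lag hf hg u)).differentiable (by norm_num) (x, y)
  have := HasFDerivAt.comp x (f := fun x' : ℝ => (x', y)) h.hasFDerivAt
    (hasFDerivAt_prodMk_left x y)
  rw [LagMix]
  erw [this.hasDerivAt.deriv]
  simp

lemma LagYY_symm {m p : ℕ} {f : ℝ × Eu m → ℝ} {g : ℝ × Eu m → Fin p → ℝ}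
    (hf : ContDiff ℝ 3 f) (hg : ∀ j, ContDiff ℝ 3 (fun z => g z j)) (u : Fin p → ℝ)
    (x : ℝ) (y v w : Eu m) :
    ⟪LagYY f g u x y w, v⟫ = ⟪LagYY f g u x y v, w⟫ := by
  have hL := contDiff_Lag hf hg u
  have hd : Differentiable ℝ (Lag f g u) := hL.differentiable (by norm_num)
  have key : ∀ v w : Eu m, ⟪LagYY f g u x y w, v⟫ =
      fderiv ℝ (fderiv ℝ (Lag f g u)) (x, y) (0, w) (0, v) := by
    intro v w
    rw [LagYY_apply hf hg]
    have h := (contDiff_gradY hL).differentiable (by norm_num) (x, y)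
    have h1 : HasFDerivAt (fun z : ℝ × Eu m => ⟪gradY (Lag f g u) z.1 z.2, v⟫) _ (x, y) :=
      h.hasFDerivAt.inner ℝ (hasFDerivAt_const v (x, y))
    have e : (fun z : ℝ × Eu m => ⟪gradY (Lag f g u) z.1 z.2, v⟫) =
        fun z => fderiv ℝ (Lag f g u) z (0, v) := by
      funext z; exact inner_gradY (hd _) v
    rw [e] at h1
    have h2 : DifferentiableAt ℝ (fderiv ℝ (Lag f g u)) (x, y) :=
      (hL.fderiv_right (m := 1) (by norm_num)).differentiable (by norm_num) _
    have h3 := h2.hasFDerivAt.clm_apply (hasFDerivAt_const ((0 : ℝ), v) (x, y))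
    have h4 := congrArg (fun T => T ((0 : ℝ), w)) (h1.unique h3)
    simpa using h4
  rw [key, key]
  exact (hL.contDiffAt.isSymmSndFDerivAt (by simp; norm_num)) _ _

lemma ift_curve {E : Type*} [NormedAddCommGroup E] [NormedSpace ℝ E] [FiniteDimensional ℝ E]
    {H : ℝ × E → E} {H' : ℝ × E →L[ℝ] E} {x0 : ℝ} {q0 : E}
    (hH : HasStrictFDerivAt H H' (x0, q0)) (h0 : H (x0, q0) = 0)
    (hinj : ∀ q, H' (0, q) = 0 → q = 0) :
    ∃ (q : ℝ → E) (q' : E), HasDerivAt q q' x0 ∧ q x0 = q0 ∧ H' (1, q') = 0 ∧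
      (∀ᶠ x in 𝓝 x0, H (x, q x) = 0) ∧ (∀ᶠ z in 𝓝 (x0, q0), H z = 0 → q z.1 = z.2) ∧
      (∀ e, ∃ q, H' (0, q) = e) := by
  have : CompleteSpace E := FiniteDimensional.complete ℝ E
  let T : E →L[ℝ] E := H' ∘L .inr ℝ ℝ E
  have hTi : Function.Injective (T : E →ₗ[ℝ] E) := by
    rw [← LinearMap.ker_eq_bot, LinearMap.ker_eq_bot']
    intro q hq
    exact hinj q (by simpa [T] using hq)
  have hTs : Function.Surjective (T : E →ₗ[ℝ] E) := LinearMap.injective_iff_surjective.1 hTi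
  have hinv : T.IsInvertible :=
    ⟨(LinearEquiv.ofBijective (T : E →ₗ[ℝ] E) ⟨hTi, hTs⟩).toContinuousLinearEquiv, by ext; rfl⟩
  have hd := hH.hasStrictFDerivAt_implicitFunctionOfProdDomain hinv
  have hev := hH.eventually_apply_implicitFunctionOfProdDomain hinv
  have hiff := hH.eventually_apply_eq_iff_implicitFunctionOfProdDomain hinv
  set q := hH.implicitFunctionOfProdDomain hinv
  have hq0 : q x0 = q0 := hiff.self_of_nhds.1 rfl
  have hdq := hd.hasFDerivAt.hasDerivAt
  rw [h0] at hev
  refine ⟨q, _, hdq, hq0, ?_, hev, ?_, ?_⟩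
  · have h1 : HasDerivAt (fun x => H (x, q x)) _ x0 :=
      HasFDerivAt.comp_hasDerivAt (x := x0) (f := fun x => (x, q x)) (hq0.symm ▸ hH.hasFDerivAt)
        ((hasDerivAt_id x0).prodMk hdq)
    exact h1.unique ((hasDerivAt_const x0 (0 : E)).congr_of_eventuallyEq hev)
  · filter_upwards [hiff] with z hz h
    exact hz.1 (h.trans h0.symm)
  · intro e
    obtain ⟨q, hq⟩ := hTs e
    exact ⟨q, by simpa [T] using hq⟩

lemma sum_subtype_zero {p : ℕ} {M : Type*} [AddCommMonoid M] (J : Fin p → Prop) (h : Fin p → M)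
    (h0 : ∀ j, ¬ J j → h j = 0) : ∑ i : {j // J j}, h i.1 = ∑ j, h j := by
  rw [← Finset.sum_subtype (Finset.univ.filter J) (by simp) h, Finset.sum_filter]
  apply Finset.sum_congr rfl
  intro j _
  split_ifs with hj
  · rfl
  · exact (h0 j hj).symm

lemma clm_split {E F : Type*} [NormedAddCommGroup E] [NormedSpace ℝ E] [NormedAddCommGroup F]
    [NormedSpace ℝ F] (T : ℝ × E →L[ℝ] F) (t : ℝ) (w : E) :
    T (t, w) = t • T (1, 0) + T (0, w) := by
  rw [← map_smul, ← map_add]; simp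

lemma licq_stable {m p : ℕ} (J : Fin p → Prop) (a : Fin p → Eu m)
    (hLI : LinearIndependent ℝ (fun j : {j : Fin p // J j} => a j.1)) :
    ∃ c > 0, ∀ b : Fin p → Eu m, (∀ j, ‖b j - a j‖ ≤ c) → ∀ v : Fin p → ℝ,
      (∀ j, ¬ J j → v j = 0) → c * ‖v‖ ≤ ‖∑ j, v j • b j‖ := by
  let T := Fintype.linearCombination ℝ (fun j : {j : Fin p // J j} => a j.1)
  have hT : LinearMap.ker T = ⊥ := by
    rw [LinearMap.ker_eq_bot']
    intro v hv
    funext j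
    exact Fintype.linearIndependent_iff.1 hLI v (by simpa [T, Fintype.linearCombination_apply] using hv) j
  obtain ⟨K, hK, hanti⟩ := T.exists_antilipschitzWith hT
  have hK' : (0 : ℝ) < K := by exact_mod_cast hK
  have hp : (0 : ℝ) < (p : ℝ) + 1 := by positivity
  refine ⟨(K : ℝ)⁻¹ / (p + 1), by positivity, ?_⟩
  set c : ℝ := (K : ℝ)⁻¹ / (p + 1) with hc
  have hcp : 0 < c := by positivity
  intro b hb v hv
  have h1 : ‖v‖ ≤ K * ‖∑ j, v j • a j‖ := by
    have e : T (fun j => v j.1) = ∑ j, v j • a j := by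
      simp only [T, Fintype.linearCombination_apply]
      exact sum_subtype_zero J (fun j => v j • a j) fun j h => by simp [hv j h]
    have h2 : ‖(fun j : {j // J j} => v j.1)‖ ≤ K * ‖T (fun j => v j.1)‖ := by
      have := hanti.le_mul_dist (fun j : {j // J j} => v j.1) 0
      simpa [dist_eq_norm] using this
    rw [e] at h2
    refine le_trans ?_ h2
    rw [pi_norm_le_iff_of_nonneg (norm_nonneg _)]
    intro j
    by_cases h : J j
    · exact norm_le_pi_norm (fun j : {j // J j} => v j.1) ⟨j, h⟩
    · simp [hv j h]
  have h3 : ‖∑ j, v j • a j‖ ≤ ‖∑ j, v j • b j‖ + p * (c * ‖v‖) := by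
    have e : ∑ j, v j • a j = ∑ j, v j • b j - ∑ j, v j • (b j - a j) := by
      simp [smul_sub]
    rw [e]
    refine (norm_sub_le _ _).trans (add_le_add le_rfl ?_)
    refine (norm_sum_le _ _).trans ?_
    refine (Finset.sum_le_card_nsmul _ _ (c * ‖v‖) ?_).trans (by simp)
    intro j _
    rw [norm_smul, mul_comm]
    exact mul_le_mul (hb j) (norm_le_pi_norm v j) (norm_nonneg _) hcp.le
  have h4 : (p + 1) * (c * ‖v‖) ≤ ‖∑ j, v j • a j‖ := by
    rw [hc]
    have : (p + 1) * ((K : ℝ)⁻¹ / (p + 1) * ‖v‖) = (K : ℝ)⁻¹ * ‖v‖ := by field_simp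
    rw [this, inv_mul_le_iff₀ hK']
    exact h1
  linarith

lemma sol_multipliers {m p : ℕ} {f : ℝ × Eu m → ℝ} {g : ℝ × Eu m → Fin p → ℝ}
    (hf : ContDiff ℝ 3 f) (hg : ∀ j, ContDiff ℝ 3 (fun z => g z j)) {x : ℝ} {y : Eu m}
    (hy : y ∈ Sset f g x) :
    ∃ (L : Fin p → ℝ) (L0 : ℝ), (L0 = 0 → L ≠ 0) ∧ (∀ j, g (x, y) j ≠ 0 → L j = 0) ∧
      ∑ j, L j • gradYg g x y j + L0 • gradY f x y = 0 := by
  have hsl : ∀ {k : ℝ × Eu m → ℝ}, ContDiff ℝ 3 k →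
      HasStrictFDerivAt (fun y' => k (x, y')) (InnerProductSpace.toDual ℝ (Eu m) (gradY k x y)) y := by
    intro k hk
    have h1 : ContDiff ℝ 3 (fun y' => k (x, y')) := hk.comp (by fun_prop)
    have h2 := h1.contDiffAt.hasStrictFDerivAt (x := y) (by norm_num)
    rw [gradY, toDual_gradient]
    exact h2
  have hext : IsLocalExtrOn (fun y' => f (x, y'))
      {y' | ∀ i : {j // g (x, y) j = 0}, g (x, y') i.1 = g (x, y) i.1} y := by
    left
    have hev : ∀ᶠ y' in 𝓝 y, ∀ j, g (x, y) j ≠ 0 → g (x, y') j < 0 := by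
      rw [Filter.eventually_all]
      intro j
      by_cases h : g (x, y) j = 0
      · exact Filter.Eventually.of_forall fun _ h' => absurd h h'
      · have hlt : g (x, y) j < 0 := lt_of_le_of_ne (hy.1 j) h
        have hc : Continuous fun y' => g (x, y') j := (hg j).continuous.comp (by fun_prop)
        filter_upwards [hc.continuousAt.eventually_lt_const hlt] with y' h' _ using h'
    refine Filter.eventually_of_mem (Filter.inter_mem (nhdsWithin_le_nhds hev) self_mem_nhdsWithin) ?_
    rintro y' ⟨h1, h2⟩
    apply hy.2
    intro j
    by_cases h : g (x, y) j = 0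
    · exact ((h2 ⟨j, h⟩).trans h).le
    · exact (h1 j h).le
  obtain ⟨L, L0, hne, hsum⟩ := hext.exists_multipliers_of_hasStrictFDerivAt
    (fun i => hsl (hg i.1)) (hsl hf)
  refine ⟨fun j => if h : g (x, y) j = 0 then L ⟨j, h⟩ else 0, L0, ?_, ?_, ?_⟩
  · intro h0 h
    apply hne
    rw [Prod.mk_eq_zero]
    refine ⟨?_, h0⟩
    funext i
    have := congrFun h i.1
    simpa [i.2] using this
  · intro j hj
    simp [hj]
  · apply (InnerProductSpace.toDual ℝ (Eu m)).injective
    rw [map_zero, ← hsum, map_add, map_sum]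
    congr 1
    · rw [← sum_subtype_zero (fun j => g (x, y) j = 0)]
      · apply Finset.sum_congr rfl
        intro i _
        simp [i.2, gradYg_eq]
      · intro j h
        simp [h]
    · simp

def Hmap {m p : ℕ} (f : ℝ × Eu m → ℝ) (g : ℝ × Eu m → Fin p → ℝ) (J : Fin p → Prop) :
    ℝ × (Eu m × (Fin p → ℝ)) → Eu m × (Fin p → ℝ) := fun z =>
  (gradY f z.1 z.2.1 + ∑ j, (if J j then z.2.2 j else 0) • gradYg g z.1 z.2.1 j,
    fun j => if J j then g (z.1, z.2.1) j else z.2.2 j)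

lemma Hmap_deriv {m p : ℕ} {f : ℝ × Eu m → ℝ} {g : ℝ × Eu m → Fin p → ℝ}
    (hf : ContDiff ℝ 3 f) (hg : ∀ j, ContDiff ℝ 3 (fun z => g z j)) (J : Fin p → Prop)
    (x : ℝ) (y : Eu m) (u : Fin p → ℝ) (hu : ∀ j, ¬ J j → u j = 0) :
    ∃ H' : ℝ × (Eu m × (Fin p → ℝ)) →L[ℝ] Eu m × (Fin p → ℝ),
      HasStrictFDerivAt (Hmap f g J) H' (x, (y, u)) ∧
      ∀ (t : ℝ) (w : Eu m) (v : Fin p → ℝ), H' (t, (w, v)) =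
        (t • LagMix f g u x y + LagYY f g u x y w +
          ∑ j, (if J j then v j else 0) • gradYg g x y j,
         fun j => if J j then t * deriv (fun x' => g (x', y) j) x + ⟪gradYg g x y j, w⟫ else v j) := by
  let c : Fin p → (Fin p → ℝ) →L[ℝ] ℝ := fun j =>
    if J j then ContinuousLinearMap.proj j else 0
  have hcv : ∀ j v, c j v = if J j then v j else 0 := by
    intro j v; simp only [c]; split_ifs <;> simp
  let P : ℝ × (Eu m × (Fin p → ℝ)) →L[ℝ] ℝ × Eu m :=
    (ContinuousLinearMap.fst ℝ _ _).prod ((ContinuousLinearMap.fst ℝ _ _).comp (ContinuousLinearMap.snd ℝ _ _))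
  let Q : ℝ × (Eu m × (Fin p → ℝ)) →L[ℝ] (Fin p → ℝ) :=
    (ContinuousLinearMap.snd ℝ _ _).comp (ContinuousLinearMap.snd ℝ _ _)
  have hfd : Differentiable ℝ f := hf.differentiable (by norm_num)
  have hgd : ∀ j, Differentiable ℝ (fun z => g z j) := fun j => (hg j).differentiable (by norm_num)
  let D := fderiv ℝ (fun z : ℝ × Eu m => gradY (Lag f g u) z.1 z.2) (x, y)
  have hL : HasStrictFDerivAt (fun z : ℝ × Eu m => gradY (Lag f g u) z.1 z.2) D (x, y) :=
    (contDiff_gradY (contDiff_Lag hf hg u)).contDiffAt.hasStrictFDerivAt (by norm_num)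
  have hL' : HasStrictFDerivAt (fun z : ℝ × (Eu m × (Fin p → ℝ)) =>
      gradY (Lag f g u) z.1 z.2.1) (D.comp P) (x, (y, u)) :=
    HasStrictFDerivAt.comp (f := P) (x, (y, u)) hL P.hasStrictFDerivAt
  have hG : ∀ j, HasStrictFDerivAt (fun z : ℝ × (Eu m × (Fin p → ℝ)) => gradYg g z.1 z.2.1 j)
      ((fderiv ℝ (fun z : ℝ × Eu m => gradYg g z.1 z.2 j) (x, y)).comp P) (x, (y, u)) := fun j =>
    HasStrictFDerivAt.comp (f := P) (x, (y, u))
      ((contDiff_gradY (hg j)).contDiffAt.hasStrictFDerivAt (by norm_num)) P.hasStrictFDerivAt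
  have hC : ∀ j, HasStrictFDerivAt (fun z : ℝ × (Eu m × (Fin p → ℝ)) => c j (Q z - u))
      ((c j).comp Q) (x, (y, u)) := fun j =>
    HasStrictFDerivAt.comp (x, (y, u)) (c j).hasStrictFDerivAt (Q.hasStrictFDerivAt.sub_const u)
  have h1 := hL'.add (HasStrictFDerivAt.fun_sum (u := Finset.univ) fun j _ => (hC j).smul (hG j))
  have h2 : ∀ j, HasStrictFDerivAt (fun z : ℝ × (Eu m × (Fin p → ℝ)) =>
      if J j then g (z.1, z.2.1) j else z.2.2 j)
      (if J j then (fderiv ℝ (fun z => g z j) (x, y)).comp P else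
        (ContinuousLinearMap.proj j).comp Q) (x, (y, u)) := by
    intro j
    split_ifs with h
    · exact HasStrictFDerivAt.comp (f := P) (x, (y, u))
        ((hg j).contDiffAt.hasStrictFDerivAt (by norm_num)) P.hasStrictFDerivAt
    · exact ((ContinuousLinearMap.proj j).comp Q).hasStrictFDerivAt
  have h3 := h1.prodMk (hasStrictFDerivAt_pi.2 h2)
  refine ⟨_, h3.congr_of_eventuallyEq (Filter.Eventually.of_forall ?_), ?_⟩
  · rintro ⟨x', y', u'⟩
    simp only [Hmap, Prod.mk.injEq, and_true, Pi.add_apply]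
    rw [gradY_Lag hfd hgd, add_assoc, ← Finset.sum_add_distrib]
    congr 1
    apply Finset.sum_congr rfl
    intro j _
    rw [Pi.smul_apply', ← add_smul, hcv]
    congr 1
    split_ifs with h
    · simp [Q]
    · simp [hu j h]
  · intro t w v
    have hP : P (t, (w, v)) = (t, w) := rfl
    have hQ : Q (t, (w, v)) = v := rfl
    have hQ' : Q (x, (y, u)) = u := rfl
    refine Prod.ext ?_ ?_
    · simp [hP, hQ, hQ', hcv, LagYY_apply hf hg, LagMix_eq hf hg, D]
      exact clm_split _ _ _
    · funext j
      by_cases h : J j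
      · have hx : deriv (fun x' => g (x', y) j) x = fderiv ℝ (fun z => g z j) (x, y) (1, 0) := by
          have := HasFDerivAt.comp x (f := fun x' : ℝ => (x', y)) (hgd j (x, y)).hasFDerivAt
            (hasFDerivAt_prodMk_left x y)
          erw [this.hasDerivAt.deriv]
          simp
        simp only [h, if_true, hx, gradYg_eq, inner_gradY (hgd j _)]
        simp [h, hP]
        rw [clm_split]; simp
      · simp [h, hQ]

lemma near_unique {m p : ℕ} {f : ℝ × Eu m → ℝ} {g : ℝ × Eu m → Fin p → ℝ}
    (hf : ContDiff ℝ 3 f) (hg : ∀ j, ContDiff ℝ 3 (fun z => g z j))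
    {x0 : ℝ} {y0 : Eu m} {u0 : Fin p → ℝ} {J : Fin p → Prop}
    (hJ : ∀ j, J j ↔ g (x0, y0) j = 0) (hu : ∀ j, ¬ J j → u0 j = 0)
    (hLI : LinearIndependent ℝ (fun j : {j : Fin p // J j} => gradYg g x0 y0 j.1))
    (hstat : gradY f x0 y0 + ∑ j, u0 j • gradYg g x0 y0 j = 0)
    (hSC : ∀ j, J j → u0 j ≠ 0)
    (q : ℝ → Eu m × (Fin p → ℝ))
    (hq : ∀ᶠ z in 𝓝 (x0, (y0, u0)), Hmap f g J z = 0 → q z.1 = z.2) :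
    ∀ᶠ z in 𝓝 (x0, y0), z.2 ∈ Sset f g z.1 → (q z.1).1 = z.2 := by
  obtain ⟨c, hc, hst⟩ := licq_stable J _ hLI
  obtain ⟨ε, hε, hball⟩ := Metric.eventually_nhds_iff.1 hq
  have hδ : ∃ δ > 0, ∀ j, J j → δ ≤ |u0 j| := by
    have : ∀ᶠ δ in 𝓝[>] (0 : ℝ), ∀ j, J j → δ ≤ |u0 j| := by
      rw [Filter.eventually_all]
      intro j
      by_cases h : J j
      · have := abs_pos.2 (hSC j h)
        filter_upwards [nhdsWithin_le_nhds (eventually_le_nhds this)] with δ h1 _ using h1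
      · exact Filter.Eventually.of_forall fun _ h' => absurd h' h
    obtain ⟨δ, h1, h2⟩ := (this.and self_mem_nhdsWithin).exists
    exact ⟨δ, h2, h1⟩
  obtain ⟨δ, hδ, hδu⟩ := hδ
  have hGc : ∀ j, Continuous fun z : ℝ × Eu m => gradYg g z.1 z.2 j := fun j =>
    (contDiff_gradY (hg j)).continuous
  have hFc : Continuous fun z : ℝ × Eu m => gradY f z.1 z.2 := (contDiff_gradY hf).continuous
  have e1 : ∀ᶠ z in 𝓝 (x0, y0), ∀ j, ‖gradYg g z.1 z.2 j - gradYg g x0 y0 j‖ ≤ c := by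
    rw [Filter.eventually_all]
    intro j
    have h : Continuous fun z : ℝ × Eu m => ‖gradYg g z.1 z.2 j - gradYg g x0 y0 j‖ :=
      ((hGc j).sub continuous_const).norm
    exact (h.tendsto' (x0, y0) 0 (by simp)).eventually_le_const hc
  have e2 : ∀ᶠ z in 𝓝 (x0, y0),
      ‖gradY f z.1 z.2 + ∑ j, u0 j • gradYg g z.1 z.2 j‖ < c * min ε δ := by
    have h : Continuous fun z : ℝ × Eu m => ‖gradY f z.1 z.2 + ∑ j, u0 j • gradYg g z.1 z.2 j‖ :=
      (hFc.add (continuous_finsetSum _ fun j _ => (hGc j).const_smul (u0 j))).norm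
    exact (h.tendsto' (x0, y0) 0 (by simp [hstat])).eventually_lt_const (by positivity)
  have e3 : ∀ᶠ z in 𝓝 (x0, y0), ∀ j, ¬ J j → g z j ≠ 0 := by
    rw [Filter.eventually_all]
    intro j
    by_cases h : J j
    · exact Filter.Eventually.of_forall fun _ h' => absurd h h'
    · have h0 : g (x0, y0) j ≠ 0 := fun h' => h ((hJ j).2 h')
      filter_upwards [(hg j).continuous.continuousAt.eventually_ne h0] with z h1 _ using h1
  filter_upwards [e1, e2, e3, Metric.ball_mem_nhds _ hε] with z h1 h2 h3 h4 hz
  obtain ⟨x, y⟩ := z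
  obtain ⟨L, L0, hne, hsupp, hsum⟩ := sol_multipliers hf hg hz
  have hLs : ∀ j, ¬ J j → L j = 0 := fun j h => hsupp j (h3 j h)
  have hL0 : L0 ≠ 0 := by
    intro h0
    apply hne h0
    have := hst _ h1 L hLs
    simp only [h0, zero_smul, add_zero] at hsum
    simp only at this
    rw [hsum, norm_zero] at this
    have : ‖L‖ ≤ 0 := by
      by_contra hcon
      push Not at hcon
      have := mul_pos hc hcon
      linarith
    exact norm_le_zero_iff.1 this
  let u : Fin p → ℝ := fun j => L j / L0
  have hus : ∀ j, ¬ J j → u j = 0 := fun j h => by simp [u, hLs j h]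
  have hueq : gradY f x y + ∑ j, u j • gradYg g x y j = 0 := by
    have e : gradY f x y + ∑ j, u j • gradYg g x y j =
        L0⁻¹ • (∑ j, L j • gradYg g x y j + L0 • gradY f x y) := by
      rw [smul_add, smul_smul, inv_mul_cancel₀ hL0, one_smul, add_comm, Finset.smul_sum]
      congr 1
      apply Finset.sum_congr rfl
      intro j _
      rw [smul_smul]; congr 1; simp only [u]; field_simp
    rw [e, hsum, smul_zero]
  have hud : ‖u - u0‖ < min ε δ := by
    have h5 := hst _ h1 (u - u0) (fun j h => by simp [hus j h, hu j h])
    have e : ∑ j, (u - u0) j • gradYg g x y j =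
        -(gradY f x y + ∑ j, u0 j • gradYg g x y j) := by
      simp only [Pi.sub_apply, sub_smul, Finset.sum_sub_distrib]
      rw [eq_neg_of_add_eq_zero_right hueq]; abel
    simp only at h5 h2
    rw [e, norm_neg] at h5
    exact lt_of_mul_lt_mul_left (h5.trans_lt h2) hc.le
  have hgz : ∀ j, J j → g (x, y) j = 0 := by
    intro j hj
    by_contra hcon
    have huj : u j = 0 := by simp [u, hsupp j hcon]
    have := norm_le_pi_norm (u - u0) j
    simp only [Pi.sub_apply, huj, zero_sub, norm_neg, Real.norm_eq_abs] at this
    have h6 := hδu j hj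
    have h7 := hud.trans_le (min_le_right _ _)
    linarith
  have hH : Hmap f g J (x, (y, u)) = 0 := by
    refine Prod.ext ?_ ?_
    · simp only [Hmap, Prod.fst_zero]
      rw [← hueq]
      congr 1
      apply Finset.sum_congr rfl
      intro j _
      split_ifs with h
      · rfl
      · rw [hus j h]
    · funext j
      by_cases h : J j
      · simp [Hmap, h, hgz j h]
      · simp [Hmap, h, hus j h]
  have h4' := h4
  rw [Metric.mem_ball, Prod.dist_eq, max_lt_iff] at h4'
  have := hball (y := (x, (y, u))) (by
    rw [Prod.dist_eq, Prod.dist_eq, max_lt_iff, max_lt_iff]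
    refine ⟨h4'.1, h4'.2, ?_⟩
    rw [dist_eq_norm]
    exact hud.trans_le (min_le_left _ _)) hH
  simp only at this ⊢
  rw [this]

lemma sol_eventually {m p : ℕ} {f : ℝ × Eu m → ℝ} {g : ℝ × Eu m → Fin p → ℝ}
    (hf : Continuous f) {x0 : ℝ} {y0 : Eu m}
    (hIC : ∀ c : ℝ, IsCompact {z : ℝ × Eu m | |z.1 - x0| ≤ 1 ∧ f z ≤ c ∧ ∀ j, g z j ≤ 0})
    (hS : Sset f g x0 = {y0}) {Y : ℝ → Eu m} (hY : Filter.Tendsto Y (𝓝 x0) (𝓝 y0))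
    (hfe : ∀ᶠ x in 𝓝 x0, Y x ∈ Yset g x)
    (hun : ∀ᶠ z in 𝓝 (x0, y0), z.2 ∈ Sset f g z.1 → Y z.1 = z.2) :
    ∀ᶠ x in 𝓝 x0, Y x ∈ Sset f g x := by
  have hy0 : y0 ∈ Sset f g x0 := by rw [hS]; rfl
  have hfY : Filter.Tendsto (fun x => f (x, Y x)) (𝓝 x0) (𝓝 (f (x0, y0))) :=
    (hf.tendsto _).comp (Filter.tendsto_id.prodMk_nhds hY)
  set K := {z : ℝ × Eu m | |z.1 - x0| ≤ 1 ∧ f z ≤ f (x0, y0) + 1 ∧ ∀ j, g z j ≤ 0} with hK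
  have hKc : IsCompact K := hIC _
  have hd : ∀ᶠ x in 𝓝 x0, |x - x0| ≤ 1 := by
    filter_upwards [Metric.closedBall_mem_nhds x0 one_pos] with x hx
    simpa [Real.dist_eq] using hx
  have hfb := hfY.eventually_le_const (lt_add_one (f (x0, y0)))
  have hex : ∀ᶠ x in 𝓝 x0, ∃ y, y ∈ Sset f g x := by
    filter_upwards [hd, hfb, hfe] with x h1 h2 h3
    have hc : IsCompact (K ∩ {z | z.1 = x}) :=
      hKc.inter_right (isClosed_eq continuous_fst continuous_const)
    obtain ⟨z, hz, hmin⟩ := hc.exists_isMinOn ⟨(x, Y x), ⟨h1, h2, h3⟩, rfl⟩ hf.continuousOn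
    obtain ⟨x', y⟩ := z
    obtain ⟨⟨hz1, hz2, hz3⟩, rfl⟩ := hz
    refine ⟨y, hz3, fun y' hy' => ?_⟩
    by_cases h : f (x', y') ≤ f (x0, y0) + 1
    · exact hmin ⟨⟨h1, h, hy'⟩, rfl⟩
    · push Not at h
      exact hz2.trans h.le
  choose! s hs using fun x (h : ∃ y, y ∈ Sset f g x) => h
  have hs' : ∀ᶠ x in 𝓝 x0, s x ∈ Sset f g x := hex.mono hs
  by_contra hcon
  have hfr : ∃ᶠ x in 𝓝 x0, Y x ∉ Sset f g x := Filter.not_eventually.1 hcon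
  have hne := Filter.frequently_iff_neBot.1 hfr
  obtain ⟨U, hU⟩ := Ultrafilter.exists_le (𝓝 x0 ⊓ Filter.principal {x | Y x ∉ Sset f g x})
  have hU1 : (U : Filter ℝ) ≤ 𝓝 x0 := hU.trans inf_le_left
  have hU2 : ∀ᶠ x in (U : Filter ℝ), Y x ∉ Sset f g x :=
    (hU.trans inf_le_right) (Filter.mem_principal_self _)
  have hle : ∀ᶠ x in (U : Filter ℝ), f (x, s x) ≤ f (x, Y x) := by
    filter_upwards [hU1 hs', hU1 hfe] with x h1 h2 using h1.2 _ h2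
  have hinK : ∀ᶠ x in (U : Filter ℝ), (x, s x) ∈ K := by
    filter_upwards [hU1 hs', hU1 hd, hU1 hfb, hle] with x h1 h2 h3 h4
    exact ⟨h2, h4.trans h3, h1.1⟩
  obtain ⟨⟨a, b⟩, hab, hlim⟩ := hKc.ultrafilter_le_nhds (U.map fun x => (x, s x))
    (Filter.le_principal_iff.2 hinK)
  have hlim' : Filter.Tendsto (fun x => (x, s x)) (U : Filter ℝ) (𝓝 (a, b)) := hlim
  have ha : a = x0 := tendsto_nhds_unique ((continuous_fst.tendsto _).comp hlim') hU1
  subst ha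
  have hfl : f (a, b) ≤ f (a, y0) :=
    le_of_tendsto_of_tendsto ((hf.tendsto _).comp hlim') (hfY.mono_left hU1) hle
  have hb : b ∈ Sset f g a := ⟨hab.2.2, fun y' hy' => hfl.trans (hy0.2 y' hy')⟩
  rw [hS] at hb
  obtain rfl : b = y0 := hb
  have := hlim'.eventually hun
  have hF : ∀ᶠ x in (U : Filter ℝ), False := by
    filter_upwards [this, hU2, hU1 hs'] with x h1 h2 h3
    rw [h1 h3] at h2
    exact h2 h3
  obtain ⟨_, h⟩ := hF.exists
  exact h

theorem statement14 {m p : ℕ}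
    (F f : ℝ × EuclideanSpace ℝ (Fin m) → ℝ)
    (g : ℝ × EuclideanSpace ℝ (Fin m) → Fin p → ℝ)
    (hF : ContDiff ℝ 1 F) (hf : ContDiff ℝ 3 f) (hg : ContDiff ℝ 3 g)
    (xbar : ℝ) (ybar : EuclideanSpace ℝ (Fin m))
    -- inf-compactness at x̄
    (hIC : ∀ c : ℝ, IsCompact {z : ℝ × EuclideanSpace ℝ (Fin m) |
      |z.1 - xbar| ≤ 1 ∧ f z ≤ c ∧ ∀ j, g z j ≤ 0})
    -- (x̄,ȳ) is a local minimizer of the bilevel program (no upper-level constraints)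
    (hfeas : ybar ∈ Sset f g xbar)
    (hlocal : ∃ U ∈ 𝓝 (xbar, ybar), ∀ z ∈ U, z.2 ∈ Sset f g z.1 →
      F (xbar, ybar) ≤ F z)
    -- S(x̄) = {ȳ}
    (hS : Sset f g xbar = {ybar})
    (ubar : Fin p → ℝ)
    -- ū is extended by zero outside J₀
    (husupp : ∀ j, g (xbar, ybar) j ≠ 0 → ubar j = 0)
    -- ND1 (LICQ) and the multiplier rule
    (hLICQ : LinearIndependent ℝ
      (fun j : {j : Fin p // g (xbar, ybar) j = 0} => gradYg g xbar ybar j.1))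
    (hstat : gradY f xbar ybar + ∑ j, ubar j • gradYg g xbar ybar j = 0)
    -- ND2 (strict complementarity)
    (hSC : ∀ j, g (xbar, ybar) j = 0 → ubar j ≠ 0)
    -- ND3 (second-order condition)
    (hSOC : ∀ w : EuclideanSpace ℝ (Fin m),
      (∀ j, g (xbar, ybar) j = 0 → ⟪gradYg g xbar ybar j, w⟫ = 0) →
      (∀ v : EuclideanSpace ℝ (Fin m),
        (∀ j, g (xbar, ybar) j = 0 → ⟪gradYg g xbar ybar j, v⟫ = 0) →
        ⟪LagYY f g ubar xbar ybar w, v⟫ = 0) →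
      w = 0) :
    -- (a) (x̄,ȳ,ū) is a local solution of the reduced NLP
    (∃ W ∈ 𝓝 ((xbar, ybar), ubar),
      ∀ (x : ℝ) (y : EuclideanSpace ℝ (Fin m)) (u : Fin p → ℝ),
        ((x, y), u) ∈ W →
        gradY f x y + ∑ j, (if g (xbar, ybar) j = 0 then u j else 0) • gradYg g x y j = 0 →
        (∀ j, g (xbar, ybar) j = 0 → g (x, y) j = 0) →
        F (xbar, ybar) ≤ F (x, y))
    ∧
    -- (b) the KKT conditions for the reduced NLP hold at (x̄,ȳ,ū)
    (∃ (w : EuclideanSpace ℝ (Fin m)) (ξ : Fin p → ℝ),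
      0 = deriv (fun x => F (x, ybar)) xbar - ⟪LagMix f g ubar xbar ybar, w⟫
          + deriv (fun x => ∑ i, ξ i * g (x, ybar) i) xbar ∧
      (0 : EuclideanSpace ℝ (Fin m))
        = gradY F xbar ybar - LagYY f g ubar xbar ybar w
          + gradY (fun z => ∑ i, ξ i * g z i) xbar ybar ∧
      (∀ i, g (xbar, ybar) i ≠ 0 → ξ i = 0) ∧
      (∀ j, g (xbar, ybar) j = 0 → ⟪gradYg g xbar ybar j, w⟫ = 0)) := by
  have hgj : ∀ j, ContDiff ℝ 3 (fun z => g z j) := fun j => contDiff_pi.1 hg j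
  have hgd : ∀ j, Differentiable ℝ (fun z => g z j) := fun j =>
    (hgj j).differentiable (by norm_num)
  have hFd : Differentiable ℝ F := hF.differentiable (by norm_num)
  let J : Fin p → Prop := fun j => g (xbar, ybar) j = 0
  have husupp' : ∀ j, ¬ J j → ubar j = 0 := husupp
  obtain ⟨H', hH', hHf⟩ := Hmap_deriv hf hgj J xbar ybar ubar husupp
  have hsumJ : ∀ v : Fin p → ℝ, (∀ j, ¬ J j → v j = 0) → ∀ a : Fin p → Eu m,
      ∑ j, (if J j then v j else 0) • a j = ∑ j, v j • a j := by
    intro v hv a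
    apply Finset.sum_congr rfl
    intro j _
    split_ifs with h
    · rfl
    · rw [hv j h]
  have h0 : Hmap f g J (xbar, (ybar, ubar)) = 0 := by
    refine Prod.ext ?_ ?_
    · simp only [Hmap, Prod.fst_zero]
      rw [hsumJ _ husupp']
      exact hstat
    · funext j
      by_cases h : J j
      · simp only [Hmap, h, if_true]; exact h
      · simp [Hmap, h, husupp' j h]
  have hinj : ∀ r, H' (0, r) = 0 → r = 0 := by
    rintro ⟨w, v⟩ hr
    rw [hHf] at hr
    have hr1 := congrArg Prod.fst hr
    have hr2 : ∀ j, _ := fun j => congrFun (congrArg Prod.snd hr) j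
    simp only [zero_smul, zero_add, Prod.fst_zero] at hr1
    simp only [zero_mul, zero_add, Prod.snd_zero, Pi.zero_apply] at hr2
    have hw : ∀ j, J j → ⟪gradYg g xbar ybar j, w⟫ = 0 := fun j h => by
      simpa [h] using hr2 j
    have hv : ∀ j, ¬ J j → v j = 0 := fun j h => by simpa [h] using hr2 j
    rw [hsumJ v hv] at hr1
    have hw0 : w = 0 := by
      refine hSOC w hw fun ζ hζ => ?_
      rw [eq_neg_of_add_eq_zero_left hr1, inner_neg_left, sum_inner, neg_eq_zero]
      apply Finset.sum_eq_zero
      intro j _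
      rw [inner_smul_left]
      by_cases h : J j
      · rw [hζ j h, mul_zero]
      · simp [hv j h]
    subst hw0
    rw [map_zero, zero_add, ← sum_subtype_zero J (fun j => v j • gradYg g xbar ybar j)
      (fun j h => by simp [hv j h])] at hr1
    have hv0 := Fintype.linearIndependent_iff.1 hLICQ (fun j => v j.1) hr1
    refine Prod.ext rfl ?_
    funext j
    by_cases h : J j
    · exact hv0 ⟨j, h⟩
    · exact hv j h
  obtain ⟨q, q', hq', hq0, hHq', hHq, huniq, hsurj⟩ := ift_curve hH' h0 hinj
  have hnear := near_unique hf hgj (J := J) (fun j => Iff.rfl) husupp' hLICQ hstat hSC q huniq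
  have hqt : Filter.Tendsto q (𝓝 xbar) (𝓝 (ybar, ubar)) := by
    have := hq'.continuousAt.tendsto
    rwa [hq0] at this
  have hYt : Filter.Tendsto (fun x => (q x).1) (𝓝 xbar) (𝓝 ybar) :=
    (continuous_fst.tendsto _).comp hqt
  have hpt : Filter.Tendsto (fun x => (x, (q x).1)) (𝓝 xbar) (𝓝 (xbar, ybar)) :=
    Filter.tendsto_id.prodMk_nhds hYt
  have hfe : ∀ᶠ x in 𝓝 xbar, (q x).1 ∈ Yset g x := by
    have hneg : ∀ᶠ x in 𝓝 xbar, ∀ j, ¬ J j → g (x, (q x).1) j < 0 := by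
      rw [Filter.eventually_all]
      intro j
      by_cases h : J j
      · exact Filter.Eventually.of_forall fun _ h' => absurd h h'
      · have hlt : g (xbar, ybar) j < 0 := lt_of_le_of_ne (hfeas.1 j) h
        have := ((hgj j).continuous.tendsto _).comp hpt
        filter_upwards [this.eventually_lt_const hlt] with x h1 _ using h1
    filter_upwards [hHq, hneg] with x h1 h2 j
    by_cases h : J j
    · have := congrFun (congrArg Prod.snd h1) j
      simp only [Hmap, h, if_true] at this
      exact this.le
    · exact (h2 j h).le
  have hSev := sol_eventually hf.continuous hIC hS hYt hfe hnear
  have hmin : ∀ᶠ x in 𝓝 xbar, F (xbar, ybar) ≤ F (x, (q x).1) := by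
    obtain ⟨U, hU, hUm⟩ := hlocal
    filter_upwards [hSev, hpt hU] with x h1 h2 using hUm _ h2 h1
  constructor
  · -- part (a)
    have hproj : Filter.Tendsto (fun w : (ℝ × Eu m) × (Fin p → ℝ) =>
        (w.1.1, (w.1.2, fun j => if J j then w.2 j else 0))) (𝓝 ((xbar, ybar), ubar))
        (𝓝 (xbar, (ybar, ubar))) := by
      have hc : Continuous (fun w : (ℝ × Eu m) × (Fin p → ℝ) =>
          (w.1.1, (w.1.2, fun j => if J j then w.2 j else 0))) := by
        refine (by fun_prop : Continuous fun w : (ℝ × Eu m) × (Fin p → ℝ) => w.1.1).prodMk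
          ((by fun_prop : Continuous fun w : (ℝ × Eu m) × (Fin p → ℝ) => w.1.2).prodMk
            (continuous_pi fun j => ?_))
        split_ifs <;> fun_prop
      refine hc.tendsto' _ _ ?_
      refine Prod.ext rfl (Prod.ext rfl ?_)
      funext j
      simp only
      split_ifs with h
      · rfl
      · exact (husupp' j h).symm
    have hx : Filter.Tendsto (fun w : (ℝ × Eu m) × (Fin p → ℝ) => w.1.1)
        (𝓝 ((xbar, ybar), ubar)) (𝓝 xbar) :=
      (by fun_prop : Continuous fun w : (ℝ × Eu m) × (Fin p → ℝ) => w.1.1).tendsto' _ _ rfl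
    refine ⟨_, Filter.inter_mem (hproj huniq) (hx hmin), ?_⟩
    rintro x y u ⟨hw1, hw2⟩ hst hgz
    have hHz : Hmap f g J (x, (y, fun j => if J j then u j else 0)) = 0 := by
      refine Prod.ext ?_ ?_
      · simp only [Hmap, Prod.fst_zero]
        rw [← hst]
        congr 1
        apply Finset.sum_congr rfl
        intro j _
        by_cases h : g (xbar, ybar) j = 0
        · simp [J, h]
        · simp [J, h]
      · funext j
        by_cases h : J j
        · simp [Hmap, h, hgz j h]
        · simp [Hmap, h]
    have h1 : q x = (y, fun j => if J j then u j else 0) := hw1 hHz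
    have h2 : F (xbar, ybar) ≤ F (x, (q x).1) := hw2
    rwa [h1] at h2
  · -- part (b)
    obtain ⟨y', u'⟩ := q'
    have hY' : HasDerivAt (fun x => (q x).1) y' xbar :=
      HasFDerivAt.comp_hasDerivAt (x := xbar) (l' := ContinuousLinearMap.fst ℝ (Eu m) (Fin p → ℝ))
        (ContinuousLinearMap.fst ℝ (Eu m) (Fin p → ℝ)).hasFDerivAt hq'
    have hφ : HasDerivAt (fun x => F (x, (q x).1)) (fderiv ℝ F (xbar, ybar) (1, y')) xbar := by
      refine HasFDerivAt.comp_hasDerivAt (x := xbar) (f := fun x => (x, (q x).1)) ?_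
        ((hasDerivAt_id xbar).prodMk hY')
      simp only [hq0]
      exact (hFd _).hasFDerivAt
    have hφ0 : fderiv ℝ F (xbar, ybar) (1, y') = 0 := by
      refine IsLocalMin.hasDerivAt_eq_zero (a := xbar) ?_ hφ
      filter_upwards [hmin] with x hx
      simpa [hq0] using hx
    have hslx : ∀ {k : ℝ × Eu m → ℝ}, Differentiable ℝ k →
        HasDerivAt (fun x => k (x, ybar)) (fderiv ℝ k (xbar, ybar) (1, 0)) xbar := by
      intro k hk
      have := HasFDerivAt.comp xbar (f := fun x' : ℝ => (x', ybar)) (hk (xbar, ybar)).hasFDerivAt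
        (hasFDerivAt_prodMk_left xbar ybar)
      have h2 := this.hasDerivAt
      simp only [ContinuousLinearMap.comp_apply, ContinuousLinearMap.inl_apply] at h2
      exact h2
    rw [clm_split, one_smul, ← inner_gradY (hFd _), ← (hslx hFd).deriv] at hφ0
    rw [hHf] at hHq'
    have k1 := congrArg Prod.fst hHq'
    have k2 : ∀ j, _ := fun j => congrFun (congrArg Prod.snd hHq') j
    simp only [one_smul, Prod.fst_zero] at k1
    simp only [one_mul, Prod.snd_zero, Pi.zero_apply] at k2
    obtain ⟨⟨w, v⟩, hwv⟩ := hsurj (gradY F xbar ybar, 0)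
    rw [hHf] at hwv
    have l1 := congrArg Prod.fst hwv
    have l2 : ∀ j, _ := fun j => congrFun (congrArg Prod.snd hwv) j
    simp only [zero_smul, zero_add] at l1
    simp only [zero_mul, zero_add, Pi.zero_apply] at l2
    have hw : ∀ j, J j → ⟪gradYg g xbar ybar j, w⟫ = 0 := fun j h => by
      simpa [h] using l2 j
    have hv : ∀ j, ¬ J j → v j = 0 := fun j h => by simpa [h] using l2 j
    rw [hsumJ v hv] at l1
    refine ⟨w, fun j => -v j, ?_, ?_, fun j h => by simp [hv j h], hw⟩
    · have hd : deriv (fun x => ∑ i, -v i * g (x, ybar) i) xbar =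
          ∑ i, -v i * deriv (fun x => g (x, ybar) i) xbar := by
        have := HasDerivAt.fun_sum (u := Finset.univ) fun (i : Fin p) _ =>
          (hslx (hgd i)).differentiableAt.hasDerivAt.const_mul (-v i)
        exact this.deriv
      rw [hd]
      have m1 : ⟪gradY F xbar ybar, y'⟫ = ⟪LagYY f g ubar xbar ybar y', w⟫ +
          ∑ i, -v i * deriv (fun x => g (x, ybar) i) xbar := by
        rw [← l1, inner_add_left, LagYY_symm hf hgj, sum_inner]
        congr 1
        apply Finset.sum_congr rfl
        intro j _
        rw [inner_smul_left]
        by_cases h : J j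
        · have := k2 j
          simp only [h, if_true] at this
          rw [eq_neg_of_add_eq_zero_right this]
          simp
        · simp [hv j h]
      have m2 : ⟪LagMix f g ubar xbar ybar, w⟫ + ⟪LagYY f g ubar xbar ybar y', w⟫ = 0 := by
        have := congrArg (fun r => ⟪r, w⟫) k1
        simp only [inner_add_left, sum_inner, inner_smul_left, inner_zero_left] at this
        rw [Finset.sum_eq_zero, add_zero] at this
        · exact this
        · intro j _
          by_cases h : J j
          · rw [hw j h, mul_zero]
          · simp [h]
      linarith
    · have e : gradY (fun z => ∑ i, -v i * g z i) xbar ybar =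
          ∑ i, (-v i) • gradYg g xbar ybar i := by
        have h1 := gradY_Lag (f := fun _ => (0 : ℝ)) (differentiable_const _) hgd
          (fun i => -v i) xbar ybar
        have h2 : Lag (fun _ => (0 : ℝ)) g (fun i => -v i) = fun z => ∑ i, -v i * g z i := by
          funext z; simp [Lag]
        have h3 : gradY (fun _ : ℝ × Eu m => (0 : ℝ)) xbar ybar = 0 := by
          simp [gradY, gradient]
        rw [h2, h3, zero_add] at h1
        exact h1
      rw [e, ← l1]
      simp
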